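/- Let d ≥ 2 be an integer. For all a > 0 and all x ∈ ℝ^d \ {0}, (∂/∂a)( a^{3−d} (∂/∂a)( G_a(x)/|x|² ) ) = a^{3−d} G_a(x). -/

import Mathlib

open MeasureTheory Metric Set Filter
open scoped RealInnerProductSpace Topology ENNReal

noncomputable section

/-- The modified Bessel function of the second kind of order `α`:
`K_α(t) = ∫_0^∞ exp (-t cosh r) cosh (α r) dr`. -/
def besselK (α t : ℝ) : ℝ :=
  ∫ r in Set.Ioi (0:ℝ), Real.exp (-t * Real.cosh r) * Real.cosh (α * r)

/-- `G(x) = (2π)^{-d/2} |x|^{1-d/2} K_{d/2-1}(|x|)`. -/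
def Gfun (d : ℕ) (x : EuclideanSpace ℝ (Fin d)) : ℝ :=
  (2 * Real.pi) ^ (-(d:ℝ)/2) * ‖x‖ ^ (1 - (d:ℝ)/2) * besselK ((d:ℝ)/2 - 1) ‖x‖

/-- `H(x) = (2π)^{-d/2} |x|^{1-d/2} K'_{d/2-1}(|x|)`. -/
def Hfun (d : ℕ) (x : EuclideanSpace ℝ (Fin d)) : ℝ :=
  (2 * Real.pi) ^ (-(d:ℝ)/2) * ‖x‖ ^ (1 - (d:ℝ)/2) * deriv (besselK ((d:ℝ)/2 - 1)) ‖x‖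

/-- `W(x) = (2π)^{-d/2} ∫_{|x|}^∞ t^{d/2-1} K_{d/2-1}(t) dt`. -/
def Wfun (d : ℕ) (x : EuclideanSpace ℝ (Fin d)) : ℝ :=
  (2 * Real.pi) ^ (-(d:ℝ)/2) * ∫ t in Set.Ioi ‖x‖, t ^ ((d:ℝ)/2 - 1) * besselK ((d:ℝ)/2 - 1) t

/-- `F(x) = (1 - d/2) G(x)/|x| - H(x)`. -/
def Ffun (d : ℕ) (x : EuclideanSpace ℝ (Fin d)) : ℝ :=
  (1 - (d:ℝ)/2) * Gfun d x / ‖x‖ - Hfun d x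

/-- The Bessel potential `G_a(x) = a^{d-2} G(ax)`. -/
def Ga (d : ℕ) (a : ℝ) (x : EuclideanSpace ℝ (Fin d)) : ℝ := a ^ ((d:ℝ) - 2) * Gfun d (a • x)

/-- `H_a(x) = a^{d-2} H(ax)`. -/
def Ha (d : ℕ) (a : ℝ) (x : EuclideanSpace ℝ (Fin d)) : ℝ := a ^ ((d:ℝ) - 2) * Hfun d (a • x)

/-- `W_a(x) = W(ax)`. -/
def Wa (d : ℕ) (a : ℝ) (x : EuclideanSpace ℝ (Fin d)) : ℝ := Wfun d (a • x)

/-- `F_a(x) = a^d F(ax)`. -/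
def Fa (d : ℕ) (a : ℝ) (x : EuclideanSpace ℝ (Fin d)) : ℝ := a ^ (d:ℝ) * Ffun d (a • x)

/-- `Ω ⊂ ℝ^d` is a bounded domain (open, connected, bounded) with `C²` boundary:
near every boundary point, `Ω` and `∂Ω` are the sublevel/level set of a `C²` defining
function with nonvanishing differential. -/
def IsBoundedC2Domain {d : ℕ} (Ω : Set (EuclideanSpace ℝ (Fin d))) : Prop :=
  IsOpen Ω ∧ IsConnected Ω ∧ Bornology.IsBounded Ω ∧
    ∀ x ∈ frontier Ω, ∃ (U : Set (EuclideanSpace ℝ (Fin d))) (f : EuclideanSpace ℝ (Fin d) → ℝ),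
      IsOpen U ∧ x ∈ U ∧ ContDiff ℝ 2 f ∧ (∀ y ∈ U, fderiv ℝ f y ≠ 0) ∧
      Ω ∩ U = {y ∈ U | f y < 0} ∧ frontier Ω ∩ U = {y ∈ U | f y = 0}

/-- `ν` is the outward unit normal vector field on `∂Ω`. -/
def IsOutwardUnitNormal {d : ℕ} (Ω : Set (EuclideanSpace ℝ (Fin d)))
    (ν : EuclideanSpace ℝ (Fin d) → EuclideanSpace ℝ (Fin d)) : Prop :=
  ∀ x ∈ frontier Ω, ‖ν x‖ = 1 ∧
    ∃ ε > 0, ∀ t : ℝ, t ∈ Set.Ioo 0 ε → x + t • ν x ∉ closure Ω ∧ x - t • ν x ∈ Ω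

/-- `Ω` is an (open) ball. -/
def IsBall {d : ℕ} (Ω : Set (EuclideanSpace ℝ (Fin d))) : Prop :=
  ∃ (c : EuclideanSpace ℝ (Fin d)) (r : ℝ), 0 < r ∧ Ω = Metric.ball c r

/-- `κ = (2π)^{-d/2} ∫_0^∞ t^{d/2-1} K_{d/2-1}(t) dt`. -/
def kappa (d : ℕ) : ℝ :=
  (2 * Real.pi) ^ (-(d:ℝ)/2) * ∫ t in Set.Ioi (0:ℝ), t ^ ((d:ℝ)/2 - 1) * besselK ((d:ℝ)/2 - 1) t

/-- `κ̃ = ∫_{S^{d-1}} |x - e|^{3-d} dσ(x)`. -/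
def sphereInt (d : ℕ) (e : EuclideanSpace ℝ (Fin d)) : ℝ :=
  ∫ x in Metric.sphere (0 : EuclideanSpace ℝ (Fin d)) 1, ‖x - e‖ ^ ((3:ℝ) - d) ∂μH[(d:ℝ)-1]

/-- The double boundary integral `∫_{∂Ω}∫_{∂Ω} |ν(x)-ν(y)|²/|x-y|^{d-1} dσ(x) dσ(y)`. -/
def nuSqInt (d : ℕ) (Ω : Set (EuclideanSpace ℝ (Fin d)))
    (ν : EuclideanSpace ℝ (Fin d) → EuclideanSpace ℝ (Fin d)) : ℝ :=
  ∫ x in frontier Ω, (∫ y in frontier Ω,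
      ‖ν x - ν y‖ ^ 2 / ‖x - y‖ ^ ((d:ℝ) - 1) ∂μH[(d:ℝ)-1]) ∂μH[(d:ℝ)-1]

/-- The nonlocal perimeter `Λ(Ω,a) = ∫_{Ω^c}∫_Ω G_a(x-y) dx dy`. -/
def Lam (d : ℕ) (Ω : Set (EuclideanSpace ℝ (Fin d))) (a : ℝ) : ℝ :=
  ∫ x in Ωᶜ, ∫ y in Ω, Ga d a (x - y)

/-- `Φ(Ω,a)`, written in terms of `W_a` and `F_a`. -/
def Phi (d : ℕ) (Ω : Set (EuclideanSpace ℝ (Fin d)))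
    (ν : EuclideanSpace ℝ (Fin d) → EuclideanSpace ℝ (Fin d)) (a : ℝ) : ℝ :=
  (∫ x in frontier Ω, (∫ y in frontier Ω,
      Wa d a (x - y) * ‖ν x - ν y‖ ^ 2 / ‖x - y‖ ^ ((d:ℝ) - 1) ∂μH[(d:ℝ)-1]) ∂μH[(d:ℝ)-1])
  + 4 * ∫ x in Ωᶜ, ∫ y in Ω, Fa d a (x - y) / ‖x - y‖

/-- The kernel `exp (-t cosh r)` times any exponential in `r` is dominated by a multiple of
`exp (-r)`. -/
lemma exp_neg_mul_cosh_mul_exp_le {t : ℝ} (ht : 0 < t) (c : ℝ) {r : ℝ} (hr : 0 ≤ r) :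
    Real.exp (-t * Real.cosh r) * Real.exp (c * r)
      ≤ Real.exp ((c + 1) ^ 2 / t) * Real.exp (-1 * r) := by
  rw [← Real.exp_add, ← Real.exp_add]
  apply Real.exp_le_exp.mpr
  have hcosh : r ^ 2 / 4 ≤ Real.cosh r := by
    rw [Real.cosh_eq]
    linarith [Real.quadratic_le_exp_of_nonneg hr, Real.exp_pos (-r)]
  have hmul := mul_le_mul_of_nonneg_left hcosh ht.le
  have hsq : (c + 1) * r ≤ (c + 1) ^ 2 / t + t * (r ^ 2 / 4) := by
    have h : (c + 1) ^ 2 / t + t * (r ^ 2 / 4) - (c + 1) * r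
        = ((c + 1) - t * r / 2) ^ 2 / t := by
      field_simp
      ring
    have : 0 ≤ ((c + 1) - t * r / 2) ^ 2 / t := by positivity
    linarith
  linarith

lemma cosh_le_exp_abs (x : ℝ) : Real.cosh x ≤ Real.exp |x| := by
  rw [← Real.cosh_abs, ← Real.cosh_add_sinh]
  linarith [Real.sinh_nonneg_iff.mpr (abs_nonneg x)]

lemma cosh_pow_mul_cosh_le_exp (n : ℕ) (α : ℝ) {r : ℝ} (hr : 0 ≤ r) :
    Real.cosh r ^ n * Real.cosh (α * r) ≤ Real.exp ((n + |α|) * r) := by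
  have h₁ : Real.cosh r ≤ Real.exp r := by
    simpa [abs_of_nonneg hr] using cosh_le_exp_abs r
  have h₂ : Real.cosh (α * r) ≤ Real.exp (|α| * r) := by
    simpa [abs_mul, abs_of_nonneg hr] using cosh_le_exp_abs (α * r)
  calc Real.cosh r ^ n * Real.cosh (α * r)
      ≤ Real.exp r ^ n * Real.exp (|α| * r) := by
        gcongr
    _ = Real.exp ((n + |α|) * r) := by
        rw [← Real.exp_nat_mul, ← Real.exp_add]
        ring_nf

/-- The `n`-th moment of the integrand of `besselK` in `cosh r`; it equals `(-1)ⁿ` times the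
`n`-th derivative of `besselK α`. -/
def besselKMoment (n : ℕ) (α t : ℝ) : ℝ :=
  ∫ r in Set.Ioi (0:ℝ), Real.exp (-t * Real.cosh r) * (Real.cosh r ^ n * Real.cosh (α * r))

lemma besselKMoment_zero (α t : ℝ) : besselKMoment 0 α t = besselK α t := by
  simp [besselKMoment, besselK]

lemma integrableOn_besselKMoment (n : ℕ) (α : ℝ) {t : ℝ} (ht : 0 < t) :
    IntegrableOn (fun r => Real.exp (-t * Real.cosh r) * (Real.cosh r ^ n * Real.cosh (α * r)))
      (Set.Ioi 0) := by
  refine integrable_of_isBigO_exp_neg one_pos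
    (Continuous.continuousOn (by fun_prop)) ?_
  refine Asymptotics.IsBigO.of_bound (Real.exp ((n + |α| + 1) ^ 2 / t)) ?_
  filter_upwards [eventually_ge_atTop 0] with r hr
  rw [Real.norm_of_nonneg (by positivity), Real.norm_of_nonneg (by positivity)]
  exact (mul_le_mul_of_nonneg_left (cosh_pow_mul_cosh_le_exp n α hr) (Real.exp_pos _).le).trans
    (exp_neg_mul_cosh_mul_exp_le ht _ hr)

lemma hasDerivAt_besselKMoment (n : ℕ) (α : ℝ) {t : ℝ} (ht : 0 < t) :
    HasDerivAt (besselKMoment n α) (-besselKMoment (n + 1) α t) t := by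
  have key := (hasDerivAt_integral_of_dominated_loc_of_deriv_le
    (μ := volume.restrict (Set.Ioi (0:ℝ))) (x₀ := t) (s := Set.Ioi (t / 2))
    (F := fun s r => Real.exp (-s * Real.cosh r) * (Real.cosh r ^ n * Real.cosh (α * r)))
    (F' := fun s r =>
      -(Real.exp (-s * Real.cosh r) * (Real.cosh r ^ (n + 1) * Real.cosh (α * r))))
    (bound := fun r =>
      Real.exp (-(t / 2) * Real.cosh r) * (Real.cosh r ^ (n + 1) * Real.cosh (α * r)))
    (Ioi_mem_nhds (half_lt_self ht))
    (Eventually.of_forall fun s => Continuous.aestronglyMeasurable (by fun_prop))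
    (integrableOn_besselKMoment n α ht)
    (Continuous.aestronglyMeasurable (by fun_prop))
    (Eventually.of_forall fun r s hs => ?_)
    (integrableOn_besselKMoment (n + 1) α (half_pos ht))
    (Eventually.of_forall fun r s _ => ?_)).2
  · rw [integral_neg] at key
    exact key
  · have := Real.cosh_pos r
    have := Real.cosh_pos (α * r)
    rw [norm_neg, Real.norm_of_nonneg (by positivity)]
    gcongr
    exact (Set.mem_Ioi.mp hs).le
  · have h := (((hasDerivAt_neg' s).mul_const (Real.cosh r)).exp).mul_const
      (Real.cosh r ^ n * Real.cosh (α * r))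
    refine h.congr_deriv ?_
    ring

/-- The modified Bessel equation, in terms of moments. -/
lemma sq_mul_besselKMoment_two (α : ℝ) {t : ℝ} (ht : 0 < t) :
    t ^ 2 * besselKMoment 2 α t
      = (t ^ 2 + α ^ 2) * besselKMoment 0 α t + t * besselKMoment 1 α t := by
  have i₀ := integrableOn_besselKMoment 0 α ht
  have i₁ := integrableOn_besselKMoment 1 α ht
  have i₂ := integrableOn_besselKMoment 2 α ht
  have hint := ((i₂.const_mul (t ^ 2)).sub (i₀.const_mul (t ^ 2 + α ^ 2))).sub (i₁.const_mul t)
  have hderiv : ∀ r ∈ Set.Ici (0:ℝ), HasDerivAt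
      (fun r => Real.exp (-t * Real.cosh r) *
        (-t * Real.sinh r * Real.cosh (α * r) - α * Real.sinh (α * r)))
      (t ^ 2 * (Real.exp (-t * Real.cosh r) * (Real.cosh r ^ 2 * Real.cosh (α * r)))
        - (t ^ 2 + α ^ 2) * (Real.exp (-t * Real.cosh r) * (Real.cosh r ^ 0 * Real.cosh (α * r)))
        - t * (Real.exp (-t * Real.cosh r) * (Real.cosh r ^ 1 * Real.cosh (α * r)))) r := by
    intro r _
    have hα : HasDerivAt (fun r : ℝ => α * r) α r := by
      simpa using (hasDerivAt_id r).const_mul α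
    have h := (((Real.hasDerivAt_cosh r).const_mul (-t)).exp).fun_mul
      ((((Real.hasDerivAt_sinh r).const_mul (-t)).fun_mul hα.cosh).fun_sub (hα.sinh.const_mul α))
    refine h.congr_deriv ?_
    linear_combination -(Real.exp (-t * Real.cosh r) * t ^ 2 * Real.cosh (α * r)) *
      Real.cosh_sq r
  have hlim : Tendsto (fun r => Real.exp (-t * Real.cosh r) *
      (-t * Real.sinh r * Real.cosh (α * r) - α * Real.sinh (α * r))) atTop (𝓝 0) := by
    have hbound : Tendsto (fun r : ℝ => (t + |α|) *
        (Real.exp (((1:ℕ) + |α| + 1) ^ 2 / t) * Real.exp (-1 * r))) atTop (𝓝 0) := by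
      have := (Real.tendsto_exp_neg_atTop_nhds_zero.const_mul
        (Real.exp (((1:ℕ) + |α| + 1) ^ 2 / t))).const_mul (t + |α|)
      simpa using this
    refine squeeze_zero_norm' ?_ hbound
    filter_upwards [eventually_ge_atTop 0] with r hr
    have abs_sinh_le (y : ℝ) : |Real.sinh y| ≤ Real.cosh y := by
      rw [← Real.cosh_abs y, Real.abs_sinh]
      exact (Real.sinh_lt_cosh _).le
    have c₀ := Real.cosh_pos (α * r)
    have c₁ := Real.one_le_cosh r
    have hle : |-t * Real.sinh r * Real.cosh (α * r) - α * Real.sinh (α * r)|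
        ≤ (t + |α|) * (Real.cosh r ^ 1 * Real.cosh (α * r)) := by
      calc |-t * Real.sinh r * Real.cosh (α * r) - α * Real.sinh (α * r)|
          ≤ |-t * Real.sinh r * Real.cosh (α * r)| + |α * Real.sinh (α * r)| := abs_sub _ _
        _ = t * |Real.sinh r| * Real.cosh (α * r) + |α| * (1 * |Real.sinh (α * r)|) := by
            rw [abs_mul, abs_mul, abs_mul, abs_neg, abs_of_pos ht, abs_of_pos c₀, one_mul]
        _ ≤ t * Real.cosh r * Real.cosh (α * r)
              + |α| * (Real.cosh r * Real.cosh (α * r)) := by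
            gcongr
            · exact abs_sinh_le _
            · exact abs_sinh_le _
        _ = (t + |α|) * (Real.cosh r ^ 1 * Real.cosh (α * r)) := by ring
    rw [norm_mul, Real.norm_of_nonneg (Real.exp_pos _).le, Real.norm_eq_abs]
    calc Real.exp (-t * Real.cosh r)
            * |-t * Real.sinh r * Real.cosh (α * r) - α * Real.sinh (α * r)|
        ≤ Real.exp (-t * Real.cosh r)
            * ((t + |α|) * Real.exp (((1:ℕ) + |α|) * r)) := by
          gcongr
          exact hle.trans (by gcongr; exact cosh_pow_mul_cosh_le_exp 1 α hr)
      _ = (t + |α|) * (Real.exp (-t * Real.cosh r) * Real.exp (((1:ℕ) + |α|) * r)) := by ring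
      _ ≤ _ := by
          refine mul_le_mul_of_nonneg_left ?_ (by positivity)
          exact exp_neg_mul_cosh_mul_exp_le ht _ hr
  have key := integral_Ioi_of_hasDerivAt_of_tendsto' hderiv hint hlim
  rw [integral_sub (by exact (i₂.const_mul _).sub (i₀.const_mul _)) (i₁.const_mul _),
    integral_sub (i₂.const_mul _) (i₀.const_mul _), integral_const_mul, integral_const_mul,
    integral_const_mul] at key
  simp only [Real.sinh_zero, mul_zero, zero_mul, sub_zero] at key
  unfold besselKMoment
  linarith

lemma Ga_eq_rpow_mul_besselKMoment (d : ℕ) {c : ℝ} (hc : 0 < c) (x : EuclideanSpace ℝ (Fin d)) :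
    Ga d c x = (2 * Real.pi) ^ (-(d:ℝ)/2) * ‖x‖ ^ (1 - (d:ℝ)/2) *
      (c ^ ((d:ℝ)/2 - 1) * besselKMoment 0 ((d:ℝ)/2 - 1) (c * ‖x‖)) := by
  have hpow : c ^ ((d:ℝ) - 2) * c ^ (1 - (d:ℝ)/2) = c ^ ((d:ℝ)/2 - 1) := by
    rw [← Real.rpow_add hc]
    ring_nf
  rw [Ga, Gfun, norm_smul, Real.norm_of_nonneg hc.le, Real.mul_rpow hc.le (norm_nonneg x),
    besselKMoment_zero, ← hpow]
  ring

lemma hasDerivAt_besselKMoment_mul (n : ℕ) (α : ℝ) {b ρ : ℝ} (hb : 0 < b) (hρ : 0 < ρ) :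
    HasDerivAt (fun c => besselKMoment n α (c * ρ)) (-besselKMoment (n + 1) α (b * ρ) * ρ) b := by
  have h := (hasDerivAt_besselKMoment n α (mul_pos hb hρ)).comp b
    ((hasDerivAt_id b).mul_const ρ)
  simpa [Function.comp_def] using h

/-- **Lemma 2.1, (16).** For `d ≥ 2`, `a > 0` and `x ∈ ℝ^d \ {0}`,
`∂_a ( a^{3-d} ∂_a ( G_a(x)/|x|² ) ) = a^{3-d} G_a(x)`. -/
theorem deriv_rpow_deriv_Ga (d : ℕ) (hd : 2 ≤ d) (a : ℝ) (ha : 0 < a)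
    (x : EuclideanSpace ℝ (Fin d)) (hx : x ≠ 0) :
    deriv (fun b => b ^ ((3:ℝ) - d) * deriv (fun c => Ga d c x / ‖x‖ ^ 2) b) a
      = a ^ ((3:ℝ) - d) * Ga d a x := by
  have hρ : 0 < ‖x‖ := norm_pos_iff.mpr hx
  rw [Ga_eq_rpow_mul_besselKMoment d ha x]
  set α : ℝ := (d:ℝ)/2 - 1 with hα
  set ρ := ‖x‖
  set C := (2 * Real.pi) ^ (-(d:ℝ)/2) * ρ ^ (1 - (d:ℝ)/2)
  have hdα : (3:ℝ) - d = 1 - 2 * α := by rw [hα]; ring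
  rw [hdα]
  have hfirst : ∀ b : ℝ, 0 < b → b ^ (1 - 2 * α) * deriv (fun c => Ga d c x / ρ ^ 2) b
      = C / ρ ^ 2 * (α * (b ^ (-α) * besselKMoment 0 α (b * ρ))
        - ρ * (b ^ (1 - α) * besselKMoment 1 α (b * ρ))) := by
    intro b hb
    have heq : (fun c => Ga d c x / ρ ^ 2) =ᶠ[𝓝 b]
        fun c => C / ρ ^ 2 * (c ^ α * besselKMoment 0 α (c * ρ)) := by
      filter_upwards [Ioi_mem_nhds hb] with c hc
      rw [Ga_eq_rpow_mul_besselKMoment d hc x]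
      ring
    have h := ((Real.hasDerivAt_rpow_const (p := α) (Or.inl hb.ne')).fun_mul
      (hasDerivAt_besselKMoment_mul 0 α hb hρ)).const_mul (C / ρ ^ 2)
    have e₁ : b ^ (1 - 2 * α) * b ^ (α - 1) = b ^ (-α) := by
      rw [← Real.rpow_add hb]; ring_nf
    have e₂ : b ^ (1 - 2 * α) * b ^ α = b ^ (1 - α) := by
      rw [← Real.rpow_add hb]; ring_nf
    rw [heq.deriv_eq, HasDerivAt.deriv h, ← e₁, ← e₂]
    ring
  have heq : (fun b => b ^ (1 - 2 * α) * deriv (fun c => Ga d c x / ρ ^ 2) b) =ᶠ[𝓝 a]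
      fun b => C / ρ ^ 2 * (α * (b ^ (-α) * besselKMoment 0 α (b * ρ))
        - ρ * (b ^ (1 - α) * besselKMoment 1 α (b * ρ))) := by
    filter_upwards [Ioi_mem_nhds ha] with b hb using hfirst b hb
  have h := ((((Real.hasDerivAt_rpow_const (p := -α) (Or.inl ha.ne')).fun_mul
      (hasDerivAt_besselKMoment_mul 0 α ha hρ)).const_mul α).fun_sub
    (((Real.hasDerivAt_rpow_const (p := 1 - α) (Or.inl ha.ne')).fun_mul
      (hasDerivAt_besselKMoment_mul 1 α ha hρ)).const_mul ρ)).const_mul (C / ρ ^ 2)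
  rw [heq.deriv_eq, HasDerivAt.deriv h]
  have e₁ : a ^ (-α) = a ^ (-α - 1) * a := by
    rw [← Real.rpow_add_one ha.ne']; ring_nf
  have e₂ : a ^ (1 - α) = a ^ (-α - 1) * a ^ 2 := by
    rw [← Real.rpow_natCast, ← Real.rpow_add ha]; push_cast; ring_nf
  have e₃ : (1 - α - 1 : ℝ) = -α := by ring
  have e₄ : a ^ (1 - 2 * α) * (C * (a ^ α * besselKMoment 0 α (a * ρ)))
      = C * (a ^ (1 - α) * besselKMoment 0 α (a * ρ)) := by
    have : a ^ (1 - 2 * α) * a ^ α = a ^ (1 - α) := by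
      rw [← Real.rpow_add ha]; ring_nf
    rw [← this]; ring
  rw [e₄, e₃, e₁, e₂]
  have ode := sq_mul_besselKMoment_two α (mul_pos ha hρ)
  have hC : C = C / ρ ^ 2 * ρ ^ 2 := by field_simp
  norm_num
  clear_value α ρ C
  linear_combination (C / ρ ^ 2 * a ^ (-α - 1)) * ode
    - (a ^ (-α - 1) * a ^ 2 * besselKMoment 0 α (a * ρ)) * hC
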